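/- Let m ≥ 1 and n = 2m + 1, let L be a uniformly elliptic constant-coefficient operator of order 2m on ℝⁿ, and let K : ℝⁿ → ℝ be locally integrable, continuous on ℝⁿ\{0}, homogeneous of degree −1, and a fundamental solution of L. Then K(y) > 0 for every y ∈ ℝⁿ\{0}. -/

import Mathlib

open MeasureTheory RealInnerProductSpace

noncomputable section

/-- ℝⁿ as a Euclidean space. -/
abbrev En (n : ℕ) : Type := EuclideanSpace ℝ (Fin n)

/-- The `i`-th standard basis vector of ℝⁿ. -/
def stdB (n : ℕ) (i : Fin n) : En n := EuclideanSpace.single i 1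

/-- The symbol Q(ξ) = Σ_{i₁,…,i_{2m}} A_{i₁…i_{2m}} ξ_{i₁}⋯ξ_{i_{2m}}. -/
def symbolQ (n m : ℕ) (A : (Fin (2*m) → Fin n) → ℝ) (ξ : En n) : ℝ :=
  ∑ i : Fin (2*m) → Fin n, A i * ∏ j, ξ (i j)

/-- The constant-coefficient operator
(Lψ)(x) = (−1)^m Σ A_{i₁…i_{2m}} ∂_{i₁}⋯∂_{i_{2m}} ψ(x). -/
def opL (n m : ℕ) (A : (Fin (2*m) → Fin n) → ℝ) (ψ : En n → ℝ) (x : En n) : ℝ :=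
  (-1 : ℝ)^m * ∑ i : Fin (2*m) → Fin n,
    A i * iteratedFDeriv ℝ (2*m) ψ x (fun j => stdB n (i j))

/-- K is a fundamental solution of L: ∫ K(y) (Lψ)(y) dy = ψ(0) for all ψ ∈ C_c^∞. -/
def IsFundamentalSolution (n m : ℕ) (A : (Fin (2*m) → Fin n) → ℝ) (K : En n → ℝ) : Prop :=
  ∀ ψ : En n → ℝ, ContDiff ℝ (⊤ : ℕ∞) ψ → HasCompactSupport ψ →
    ∫ y, K y * opL n m A ψ y = ψ 0

/-- K is homogeneous of degree a: K(σx) = |σ|^a K(x) for σ ≠ 0, x ≠ 0. -/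
def HomogeneousDeg (n : ℕ) (a : ℝ) (K : En n → ℝ) : Prop :=
  ∀ σ : ℝ, σ ≠ 0 → ∀ x : En n, x ≠ 0 → K (σ • x) = |σ| ^ a * K x

/-- The Euclidean Laplacian Δf(x) = Σ_i ∂²f/∂x_i²(x). -/
def lap (n : ℕ) (f : En n → ℝ) (x : En n) : ℝ :=
  ∑ i : Fin n, iteratedFDeriv ℝ 2 f x (fun _ => stdB n i)

/-- The point (x′, t) ∈ ℝ^{d} × ℝ = ℝ^{d+1}. -/
def snocVec (d : ℕ) (x' : En d) (t : ℝ) : En (d+1) :=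
  (EuclideanSpace.equiv (Fin (d+1)) ℝ).symm (Fin.snoc (fun i => x' i) t)


lemma aux_fejer (a S : ℝ) : 0 ≤ ∫ s in (0:ℝ)..S, (S - s) * Real.cos (a * s) := by
  by_cases ha : a = 0
  · subst ha
    simp only [zero_mul, Real.cos_zero, mul_one]
    rw [intervalIntegral.integral_sub (by simp) (by simp)]
    simp
    nlinarith [sq_nonneg S]
  · have h : ∀ s ∈ Set.uIcc 0 S, HasDerivAt
        (fun s => (S - s) * (Real.sin (a * s) / a) - Real.cos (a * s) / a ^ 2)
        ((S - s) * Real.cos (a * s)) s := by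
      intro s _
      have h1 : HasDerivAt (fun s => a * s) a s := by
        simpa using (hasDerivAt_id s).const_mul a
      have h2 : HasDerivAt (fun s => S - s) (-1) s := by
        simpa using (hasDerivAt_id s).const_sub S
      have h3 := (h2.mul (h1.sin.div_const a)).sub (h1.cos.div_const (a ^ 2))
      refine h3.congr_deriv ?_
      field_simp
      ring
    rw [intervalIntegral.integral_eq_sub_of_hasDerivAt h
      (Continuous.intervalIntegrable (by fun_prop) _ _)]
    simp only [sub_self, zero_mul, mul_zero, Real.sin_zero, Real.cos_zero, zero_div, zero_sub]
    have : 0 ≤ (1 - Real.cos (a * S)) / a ^ 2 :=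
      div_nonneg (by linarith [Real.cos_le_one (a * S)]) (sq_nonneg _)
    rw [sub_div] at this
    linarith

lemma aux_cosbd {n : ℕ} {H : En n → ℝ} (hH : Integrable H) (b : En n → ℝ) (hb : Continuous b) :
    Integrable (fun ξ => H ξ * Real.cos (b ξ)) := by
  refine hH.mul_bdd (c := 1) (by fun_prop) ?_
  exact Filter.Eventually.of_forall fun ξ => by
    simpa using Real.abs_cos_le_one _

lemma aux_log {n : ℕ} {H : En n → ℝ} (hH : Integrable H) (h0 : ∀ᵐ ξ, 0 ≤ H ξ) (w : En n)
    (c s0 : ℝ) (hc : 0 < c) (hs0 : 0 < s0)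
    (hf : ∀ s, s0 ≤ s → ∫ ξ, H ξ * Real.cos (2 * Real.pi * inner ℝ w ξ * s) ≤ - (c / s)) : False := by
  set f : ℝ → ℝ := fun s => ∫ ξ, H ξ * Real.cos (2 * Real.pi * inner ℝ w ξ * s) with hfdef
  set M : ℝ := ∫ ξ, ‖H ξ‖ with hM
  have hfc : Continuous f := by
    refine continuous_of_dominated (bound := fun ξ => ‖H ξ‖) ?_ ?_ hH.norm ?_
    · intro s
      exact (aux_cosbd hH _ (by fun_prop)).aestronglyMeasurable
    · intro s
      refine Filter.Eventually.of_forall fun ξ => ?_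
      rw [norm_mul]
      exact mul_le_of_le_one_right (norm_nonneg _) (by simpa using Real.abs_cos_le_one _)
    · exact Filter.Eventually.of_forall fun ξ => by fun_prop
  have hfb : ∀ s, f s ≤ M := by
    intro s
    refine integral_mono (aux_cosbd hH _ (by fun_prop)) hH.norm fun ξ => ?_
    refine (le_abs_self _).trans ?_
    rw [abs_mul]
    exact mul_le_of_le_one_right (abs_nonneg _) (Real.abs_cos_le_one _)
  have hM0 : 0 ≤ M := integral_nonneg fun _ => norm_nonneg _
  set B : ℝ := (s0 * M + c) / c + 1 with hB
  have hB0 : 0 < B := by positivity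
  set S : ℝ := s0 * Real.exp B with hS
  have hSs : s0 ≤ S := by
    have := Real.one_le_exp hB0.le
    nlinarith
  have hSpos : 0 < S := lt_of_lt_of_le hs0 hSs
  have key : 0 ≤ ∫ s in (0:ℝ)..S, (S - s) * f s := by
    have e1 : ∫ s in (0:ℝ)..S, (S - s) * f s
        = ∫ s in (0:ℝ)..S, ∫ ξ, (S - s) * (H ξ * Real.cos (2 * Real.pi * inner ℝ w ξ * s)) := by
      congr 1; ext s; rw [integral_const_mul]
    rw [e1, intervalIntegral_integral_swap]
    · refine integral_nonneg_of_ae ?_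
      filter_upwards [h0] with ξ hξ
      have : ∫ s in (0:ℝ)..S, (S - s) * (H ξ * Real.cos (2 * Real.pi * inner ℝ w ξ * s))
          = H ξ * ∫ s in (0:ℝ)..S, (S - s) * (Real.cos (2 * Real.pi * inner ℝ w ξ * s)) := by
        rw [← intervalIntegral.integral_const_mul]
        congr 1; ext s; ring
      simp only [Pi.zero_apply]
      rw [this]
      exact mul_nonneg hξ (aux_fejer _ _)
    · have hi : Integrable (fun p : ℝ × En n => S * H p.2)
          ((volume.restrict (Set.uIoc 0 S)).prod volume) := by
        have : IsFiniteMeasure (volume.restrict (Set.uIoc 0 S)) :=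
          ⟨by rw [Measure.restrict_apply_univ, Set.uIoc_of_le hSpos.le]; simp⟩
        exact ((integrable_const (S:ℝ)).mul_prod hH)
      refine hi.mono ?_ ?_
      · refine AEStronglyMeasurable.mul (by fun_prop) (AEStronglyMeasurable.mul ?_ ?_)
        · exact hH.aestronglyMeasurable.comp_snd
        · exact (Continuous.aestronglyMeasurable (by fun_prop))
      · have hae : ∀ᵐ p : ℝ × En n ∂((volume.restrict (Set.uIoc 0 S)).prod volume),
            p.1 ∈ Set.uIoc 0 S := by
          have : ∀ᵐ s ∂(volume.restrict (Set.uIoc 0 S)), s ∈ Set.uIoc (0:ℝ) S :=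
            ae_restrict_mem measurableSet_uIoc
          exact Measure.quasiMeasurePreserving_fst.ae this
        filter_upwards [hae] with p hp
        rw [Set.uIoc_of_le hSpos.le] at hp
        simp only [Function.uncurry, norm_mul]
        have h1 : ‖S - p.1‖ ≤ ‖S‖ := by
          rw [Real.norm_of_nonneg (by linarith [hp.2]), Real.norm_of_nonneg hSpos.le]
          linarith [hp.1]
        have h2 : ‖Real.cos (2 * Real.pi * inner ℝ w p.2 * p.1)‖ ≤ 1 := Real.abs_cos_le_one _
        calc _ ≤ ‖S‖ * (‖H p.2‖ * 1) := by gcongr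
          _ = _ := by ring
  have hii : ∀ a b, IntervalIntegrable (fun s => (S - s) * f s) volume a b := fun a b =>
    Continuous.intervalIntegrable (by fun_prop) _ _
  rw [← intervalIntegral.integral_add_adjacent_intervals (hii 0 s0) (hii s0 S)] at key
  have u1 : ∫ s in (0:ℝ)..s0, (S - s) * f s ≤ s0 * (S * M) := by
    have : ∫ s in (0:ℝ)..s0, (S - s) * f s ≤ ∫ s in (0:ℝ)..s0, S * M := by
      refine intervalIntegral.integral_mono_on hs0.le (hii _ _) (by simp) ?_
      intro s hs
      have := hfb s
      have h3 : (S - s) * f s ≤ (S - s) * M :=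
        mul_le_mul_of_nonneg_left this (by linarith [hs.2])
      nlinarith [hs.1]
    rw [intervalIntegral.integral_const] at this
    simpa using this
  have u2 : ∫ s in s0..S, (S - s) * f s ≤ -c * (S * B - (S - s0)) := by
    have hi2 : IntervalIntegrable (fun s : ℝ => S * s⁻¹) volume s0 S := by
      refine ContinuousOn.intervalIntegrable ?_
      refine continuousOn_const.mul (continuousOn_inv₀.mono ?_)
      intro s hs
      rw [Set.uIcc_of_le hSs] at hs
      exact ne_of_gt (lt_of_lt_of_le hs0 hs.1)
    have : ∫ s in s0..S, (S - s) * f s ≤ ∫ s in s0..S, -c * (S * s⁻¹ - 1) := by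
      refine intervalIntegral.integral_mono_on hSs (hii _ _)
        ((hi2.sub (by simp)).const_mul _) ?_
      intro s hs
      have hsp : 0 < s := lt_of_lt_of_le hs0 hs.1
      calc (S - s) * f s ≤ (S - s) * (-(c/s)) :=
            mul_le_mul_of_nonneg_left (hf s hs.1) (by linarith [hs.2])
        _ = _ := by field_simp
    refine this.trans (le_of_eq ?_)
    rw [intervalIntegral.integral_const_mul, intervalIntegral.integral_sub hi2 (by simp),
      intervalIntegral.integral_const_mul, integral_inv_of_pos hs0 hSpos]
    have : S / s0 = Real.exp B := by rw [hS]; field_simp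
    rw [this, Real.log_exp]
    simp
  have h3 : c * B = s0 * M + c + c := by rw [hB]; field_simp
  have : S * (c * B) = S * (s0 * M + c + c) := by rw [h3]
  nlinarith

open FourierTransform in
lemma aux_fourier_re {n : ℕ} {f : En n → ℝ} (hf : Integrable f) (w : En n) :
    (𝓕 (fun ξ => (f ξ : ℂ)) w).re = ∫ ξ, f ξ * Real.cos (2 * Real.pi * inner ℝ w ξ) := by
  rw [Real.fourier_eq]
  have hi : Integrable (fun v : En n => (Real.fourierChar (-inner ℝ v w)) • (f v : ℂ)) :=
    (Real.fourierIntegral_convergent_iff w).2 hf.ofReal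
  have := (Complex.reCLM.integral_comp_comm hi).symm
  simp only [Complex.reCLM_apply] at this
  rw [this]
  congr 1; ext v
  rw [Circle.smul_def, Real.fourierChar_apply, smul_eq_mul, Complex.re_mul_ofReal,
    Complex.exp_ofReal_mul_I_re, real_inner_comm]
  rw [mul_neg, Real.cos_neg, mul_comm]

lemma aux_gauss_int {n : ℕ} (b : ℝ) (hb : 0 < b) :
    Integrable (fun ξ : En n => Real.exp (-b * ‖ξ‖ ^ 2)) := by
  have := GaussianFourier.integrable_cexp_neg_mul_sq_norm_add (V := En n) (b := (b:ℂ))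
    (by simpa using hb) 0 0
  have h2 := this.re
  refine h2.congr (Filter.Eventually.of_forall fun v => ?_)
  have e : (-(b:ℂ) * (‖v‖:ℂ) ^ 2 + 0 * ((inner ℝ (0 : En n) v : ℝ) : ℂ))
      = ((-b * ‖v‖ ^ 2 : ℝ) : ℂ) := by push_cast; ring
  simp only [e]
  exact Complex.exp_ofReal_re _

lemma aux_gauss {n : ℕ} (τ : ℝ) (hτ : 0 < τ) (w : En n) :
    ∫ ξ : En n, Real.exp (-(Real.pi * τ) * ‖ξ‖ ^ 2) * Real.cos (2 * Real.pi * inner ℝ w ξ)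
      = (1 / τ) ^ ((n : ℝ) / 2) * Real.exp (-Real.pi * ‖w‖ ^ 2 / τ) := by
  have hb : 0 < Real.pi * τ := mul_pos Real.pi_pos hτ
  rw [← aux_fourier_re (aux_gauss_int _ hb)]
  have := fourier_gaussian_innerProductSpace (V := En n) (b := ((Real.pi * τ : ℝ):ℂ))
    (by simpa using hb) w
  have e : (fun ξ : En n => ((Real.exp (-(Real.pi * τ) * ‖ξ‖ ^ 2) : ℝ) : ℂ))
    = fun v => Complex.exp (-((Real.pi * τ : ℝ):ℂ) * (‖v‖:ℂ) ^ 2) := by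
    ext v; push_cast; rfl
  rw [e, this]
  have e2 : ((Real.pi : ℂ) / ((Real.pi * τ : ℝ):ℂ)) = ((1 / τ : ℝ) : ℂ) := by
    rw [← Complex.ofReal_div]; congr 1; field_simp
  have e3 : (-(Real.pi:ℂ) ^ 2 * (‖w‖:ℂ) ^ 2 / ((Real.pi * τ : ℝ):ℂ))
     = ((-Real.pi * ‖w‖ ^ 2 / τ : ℝ) : ℂ) := by
    have : (-Real.pi * ‖w‖ ^ 2 / τ : ℝ) = -Real.pi ^ 2 * ‖w‖ ^ 2 / (Real.pi * τ) := by
      field_simp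
    rw [this]; push_cast; rfl
  have e4 : ((Module.finrank ℝ (En n) : ℂ) / 2) = (((n : ℝ) / 2 : ℝ) : ℂ) := by
    simp
  rw [e2, e3, e4, ← Complex.ofReal_cpow (by positivity), ← Complex.ofReal_exp,
    ← Complex.ofReal_mul, Complex.ofReal_re]

lemma aux_gauss_one {n : ℕ} (τ : ℝ) (hτ : 0 < τ) :
    ∫ ξ : En n, Real.exp (-(Real.pi * τ) * ‖ξ‖ ^ 2) = (1 / τ) ^ ((n : ℝ) / 2) := by
  have := aux_gauss (n := n) τ hτ 0
  simpa using this

/-- Auxiliary comparison function. -/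
def G0fun (m : ℕ) (ξ : En (2*m+1)) : ℝ :=
  ∫ τ in Set.Ioi (1:ℝ), τ ^ ((m:ℝ) - 1) * Real.exp (-(Real.pi * τ) * ‖ξ‖ ^ 2)

lemma aux_powid (m : ℕ) (τ : ℝ) (hτ : 0 < τ) :
    τ ^ ((m:ℝ) - 1) * (1 / τ) ^ (((2 * m + 1 : ℕ) : ℝ) / 2) = τ ^ (-(3:ℝ)/2) := by
  rw [one_div, Real.inv_rpow hτ.le, ← Real.rpow_neg hτ.le, ← Real.rpow_add hτ]
  congr 1; push_cast; ring

lemma aux_G0_prod (m : ℕ) : Integrable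
    (Function.uncurry fun (τ : ℝ) (ξ : En (2*m+1)) =>
      τ ^ ((m:ℝ) - 1) * Real.exp (-(Real.pi * τ) * ‖ξ‖ ^ 2))
    ((volume.restrict (Set.Ioi (1:ℝ))).prod volume) := by
  have hmeas : AEStronglyMeasurable (Function.uncurry fun (τ : ℝ) (ξ : En (2*m+1)) =>
      τ ^ ((m:ℝ) - 1) * Real.exp (-(Real.pi * τ) * ‖ξ‖ ^ 2))
      ((volume.restrict (Set.Ioi (1:ℝ))).prod volume) := by
    apply Measurable.aestronglyMeasurable
    unfold Function.uncurry
    fun_prop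
  rw [integrable_prod_iff hmeas]
  constructor
  · filter_upwards [ae_restrict_mem measurableSet_Ioi] with τ hτ
    have : 0 < τ := lt_trans one_pos hτ
    exact (aux_gauss_int (Real.pi * τ) (by positivity)).const_mul (τ ^ ((m:ℝ) - 1))
  · have h1 : IntegrableOn (fun τ : ℝ => τ ^ (-(3:ℝ)/2)) (Set.Ioi 1) :=
      integrableOn_Ioi_rpow_of_lt (by norm_num) one_pos
    refine h1.congr ?_
    filter_upwards [ae_restrict_mem measurableSet_Ioi] with τ hτ
    have hτ0 : 0 < τ := lt_trans one_pos hτ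
    have : ∀ ξ : En (2*m+1), ‖Function.uncurry (fun (τ : ℝ) (ξ : En (2*m+1)) =>
      τ ^ ((m:ℝ) - 1) * Real.exp (-(Real.pi * τ) * ‖ξ‖ ^ 2)) (τ, ξ)‖
       = τ ^ ((m:ℝ) - 1) * Real.exp (-(Real.pi * τ) * ‖ξ‖ ^ 2) := by
      intro ξ
      simp only [Function.uncurry]
      exact Real.norm_of_nonneg (by positivity)
    simp only [this]
    rw [integral_const_mul, aux_gauss_one τ hτ0, aux_powid m τ hτ0]

lemma aux_G0_int (m : ℕ) : Integrable (G0fun m) := by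
  have := (aux_G0_prod m).integral_prod_right
  exact this

lemma aux_G0_cos (m : ℕ) (w : En (2*m+1)) (s : ℝ) (hs : 1 ≤ s) :
    (2:ℝ) ^ (-(3:ℝ)/2) * Real.exp (-Real.pi * ‖w‖ ^ 2) / s ≤
      ∫ ξ, G0fun m ξ * Real.cos (2 * Real.pi * inner ℝ w ξ * s) := by
  have hs0 : 0 < s := by linarith
  have e1 : ∫ ξ, G0fun m ξ * Real.cos (2 * Real.pi * inner ℝ w ξ * s)
      = ∫ τ in Set.Ioi (1:ℝ), ∫ ξ : En (2*m+1), (τ ^ ((m:ℝ) - 1) *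
        Real.exp (-(Real.pi * τ) * ‖ξ‖ ^ 2)) * Real.cos (2 * Real.pi * inner ℝ w ξ * s) := by
    rw [integral_integral_swap]
    · congr 1; ext ξ; rw [G0fun, integral_mul_const]
    · refine (aux_G0_prod m).mul_bdd (c := 1) (g := fun p : ℝ × En (2*m+1) => Real.cos (2 * Real.pi * inner ℝ w p.2 * s)) (Continuous.aestronglyMeasurable (by fun_prop)) ?_
      exact Filter.Eventually.of_forall fun p => by simpa using Real.abs_cos_le_one _
  have e2 : ∀ τ ∈ Set.Ioi (1:ℝ), ∫ ξ : En (2*m+1), (τ ^ ((m:ℝ) - 1) *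
        Real.exp (-(Real.pi * τ) * ‖ξ‖ ^ 2)) * Real.cos (2 * Real.pi * inner ℝ w ξ * s)
        = τ ^ (-(3:ℝ)/2) * Real.exp (-Real.pi * (‖w‖ * s) ^ 2 / τ) := by
    intro τ hτ
    have hτ0 : 0 < τ := lt_trans one_pos hτ
    have := aux_gauss τ hτ0 (s • w)
    rw [norm_smul, Real.norm_of_nonneg hs0.le] at this
    rw [← aux_powid m τ hτ0, mul_assoc, mul_comm ‖w‖ s, ← this, ← integral_const_mul]
    congr 1; ext ξ
    rw [inner_smul_left]
    simp only [conj_trivial]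
    rw [mul_assoc]
    have e9 : 2 * Real.pi * inner ℝ w ξ * s = 2 * Real.pi * (s * inner ℝ w ξ) := by ring
    rw [e9]
  rw [e1, setIntegral_congr_fun measurableSet_Ioi e2]
  have hint : IntegrableOn (fun τ : ℝ => τ ^ (-(3:ℝ)/2) * Real.exp (-Real.pi * (‖w‖ * s) ^ 2 / τ))
      (Set.Ioi 1) := by
    have h1 : IntegrableOn (fun τ : ℝ => τ ^ (-(3:ℝ)/2)) (Set.Ioi 1) :=
      integrableOn_Ioi_rpow_of_lt (by norm_num) one_pos
    refine h1.mul_bdd (c := 1) (Measurable.aestronglyMeasurable (by fun_prop)) ?_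
    filter_upwards [ae_restrict_mem measurableSet_Ioi] with τ hτ
    have hτ0 : 0 < τ := lt_trans one_pos hτ
    rw [Real.norm_of_nonneg (Real.exp_pos _).le]
    apply Real.exp_le_one_iff.2
    apply div_nonpos_of_nonpos_of_nonneg _ hτ0.le
    nlinarith [Real.pi_pos, sq_nonneg (‖w‖ * s), mul_nonneg Real.pi_pos.le (sq_nonneg (‖w‖ * s))]
  have hss : 1 ≤ s ^ 2 := by nlinarith
  have hsub : Set.Ioc (s^2) (2 * s^2) ⊆ Set.Ioi (1:ℝ) := fun τ hτ => lt_of_le_of_lt hss hτ.1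
  have l1 := setIntegral_mono_set hint (by
    filter_upwards [ae_restrict_mem measurableSet_Ioi] with τ hτ
    have hτ0 : 0 < τ := lt_trans one_pos hτ
    simp only [Pi.zero_apply]
    positivity) hsub.eventuallyLE
  refine le_trans ?_ l1
  have l2 : ∫ τ in Set.Ioc (s^2) (2 * s^2), (2 * s^2) ^ (-(3:ℝ)/2) * Real.exp (-Real.pi * ‖w‖ ^ 2)
     ≤ ∫ τ in Set.Ioc (s^2) (2 * s^2), τ ^ (-(3:ℝ)/2) * Real.exp (-Real.pi * (‖w‖ * s) ^ 2 / τ) := by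
    refine setIntegral_mono_on (integrableOn_const (by simp)) (hint.mono_set hsub) measurableSet_Ioc ?_
    intro τ hτ
    have hτ0 : 0 < τ := lt_trans one_pos (hsub hτ)
    have : -Real.pi * ‖w‖ ^ 2 ≤ -Real.pi * (‖w‖ * s) ^ 2 / τ := by
      rw [le_div_iff₀ hτ0]
      have : 0 ≤ Real.pi * ‖w‖ ^ 2 := by positivity
      nlinarith [hτ.1]
    have h2 : (2 * s^2) ^ (-(3:ℝ)/2) ≤ τ ^ (-(3:ℝ)/2) :=
      Real.rpow_le_rpow_of_nonpos hτ0 hτ.2 (by norm_num)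
    gcongr
  refine le_trans (le_of_eq ?_) l2
  rw [setIntegral_const]
  have e3 : (s ^ 2) ^ (-(3:ℝ)/2) = (s ^ 3)⁻¹ := by
    rw [← Real.rpow_natCast s 2, ← Real.rpow_mul hs0.le, ← Real.rpow_natCast s 3, ← Real.rpow_neg hs0.le]
    norm_num
  have e4 : (volume.real (Set.Ioc (s^2) (2 * s^2))) = s ^ 2 := by
    rw [Measure.real, Real.volume_Ioc, ENNReal.toReal_ofReal (by nlinarith)]; ring
  rw [e4, Real.mul_rpow (by norm_num) (by positivity), e3, smul_eq_mul]
  field_simp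

lemma aux_G0_le (m : ℕ) (hm : 1 ≤ m) : ∃ C : ℝ, 0 < C ∧ ∀ ξ : En (2*m+1), ξ ≠ 0 →
    G0fun m ξ ≤ C * (‖ξ‖ ^ (2*m))⁻¹ * Real.exp (-(Real.pi / 2) * ‖ξ‖ ^ 2) := by
  have hm0 : (0:ℝ) < m := by exact_mod_cast hm
  refine ⟨(1 / (Real.pi / 2)) ^ (m:ℝ) * Real.Gamma m, by
    have := Real.Gamma_pos_of_pos hm0
    positivity, fun ξ hξ => ?_⟩
  have hx : 0 < ‖ξ‖ := norm_pos_iff.2 hξ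
  set r : ℝ := Real.pi / 2 * ‖ξ‖ ^ 2 with hr
  have hr0 : 0 < r := by positivity
  have hI := Real.integral_rpow_mul_exp_neg_mul_Ioi hm0 hr0
  have hint : IntegrableOn (fun t : ℝ => t ^ ((m:ℝ) - 1) * Real.exp (-(r * t))) (Set.Ioi 0) := by
    by_contra h
    rw [integral_undef h] at hI
    have := Real.Gamma_pos_of_pos hm0
    have : 0 < (1 / r) ^ (m:ℝ) * Real.Gamma m := by positivity
    linarith
  have hpos : ∀ t ∈ Set.Ioi (0:ℝ), 0 ≤ t ^ ((m:ℝ) - 1) * Real.exp (-(r * t)) := by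
    intro t ht
    have : (0:ℝ) < t := ht
    positivity
  have hsub : Set.Ioi (1:ℝ) ⊆ Set.Ioi 0 := Set.Ioi_subset_Ioi zero_le_one
  have l1 := setIntegral_mono_set hint ((ae_restrict_mem measurableSet_Ioi).mono hpos)
    hsub.eventuallyLE
  have l2 : G0fun m ξ ≤ ∫ t in Set.Ioi (1:ℝ),
      Real.exp (-(Real.pi / 2) * ‖ξ‖ ^ 2) * (t ^ ((m:ℝ) - 1) * Real.exp (-(r * t))) := by
    refine integral_mono_of_nonneg ?_ ((hint.mono_set hsub).const_mul _) ?_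
    · filter_upwards [ae_restrict_mem measurableSet_Ioi] with t ht
      have : (0:ℝ) < t := hsub ht
      simp only [Pi.zero_apply]
      positivity
    · filter_upwards [ae_restrict_mem measurableSet_Ioi] with t ht
      have ht0 : (0:ℝ) < t := hsub ht
      have ht1 : (1:ℝ) < t := ht
      have : Real.exp (-(Real.pi * t) * ‖ξ‖ ^ 2) ≤
          Real.exp (-(Real.pi / 2) * ‖ξ‖ ^ 2) * Real.exp (-(r * t)) := by
        rw [← Real.exp_add]
        apply Real.exp_le_exp.2
        rw [hr]
        nlinarith
      calc _ ≤ t ^ ((m:ℝ) - 1) * (Real.exp (-(Real.pi / 2) * ‖ξ‖ ^ 2) * Real.exp (-(r * t))) := by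
            gcongr
        _ = _ := by ring
  rw [integral_const_mul] at l2
  rw [hI] at l1
  refine l2.trans ?_
  have e : (1 / r) ^ (m:ℝ) = (1 / (Real.pi / 2)) ^ (m:ℝ) * (‖ξ‖ ^ (2*m))⁻¹ := by
    rw [hr, Real.rpow_natCast, Real.rpow_natCast, pow_mul, ← inv_pow, ← mul_pow]
    congr 1; field_simp
  rw [e] at l1
  calc _ ≤ Real.exp (-(Real.pi / 2) * ‖ξ‖ ^ 2) * ((1 / (Real.pi / 2)) ^ (m:ℝ) * (‖ξ‖ ^ (2 * m))⁻¹ * Real.Gamma m) := by gcongr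
    _ = _ := by ring

open Filter Topology in
lemma aux_pos (m : ℕ) (G : En (2*m+1) → ℝ) (hG : Integrable G) (c C : ℝ) (hc : 0 < c)
    (hGG : ∀ ξ, ξ ≠ 0 → c * G0fun m ξ - C * Real.exp (-(Real.pi * (1/2)) * ‖ξ‖ ^ 2) ≤ G ξ)
    (w : En (2*m+1)) (hw : w ≠ 0) (l : ℝ)
    (hl : Tendsto (fun s : ℝ => s * ∫ ξ, G ξ * Real.cos (2 * Real.pi * inner ℝ w ξ * s))
      atTop (𝓝 l)) : 0 < l := by
  by_contra hneg
  push Not at hneg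
  have hge := aux_gauss_int (n := 2*m+1) (Real.pi * (1/2)) (by positivity)
  have hG0 := aux_G0_int m
  set k : ℝ := (2:ℝ) ^ (-(3:ℝ)/2) * Real.exp (-Real.pi * ‖w‖ ^ 2) with hk
  have hk0 : 0 < k := by positivity
  set D : ℝ := (1 / (1/2 : ℝ)) ^ (((2*m+1 : ℕ) : ℝ) / 2) with hD
  have hgc : ∀ s : ℝ, ∫ ξ : En (2*m+1), Real.exp (-(Real.pi * (1/2)) * ‖ξ‖ ^ 2)
      * Real.cos (2 * Real.pi * inner ℝ w ξ * s)
      = D * Real.exp (-(2 * Real.pi * ‖w‖ ^ 2) * s ^ 2) := by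
    intro s
    have := aux_gauss (1/2) (by norm_num) (s • w)
    rw [norm_smul] at this
    have e : -Real.pi * (‖s‖ * ‖w‖) ^ 2 / (1/2) = -(2 * Real.pi * ‖w‖ ^ 2) * s ^ 2 := by
      rw [mul_pow, Real.norm_eq_abs, sq_abs]; ring
    rw [e] at this
    rw [hD, ← this]
    congr 1; ext ξ
    rw [inner_smul_left]
    simp only [conj_trivial]
    have e9 : 2 * Real.pi * inner ℝ w ξ * s = 2 * Real.pi * (s * inner ℝ w ξ) := by ring
    rw [e9]
  set H : En (2*m+1) → ℝ := fun ξ =>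
    G ξ - c * G0fun m ξ + C * Real.exp (-(Real.pi * (1/2)) * ‖ξ‖ ^ 2) with hHdef
  have hH : Integrable H := (hG.sub (hG0.const_mul c)).add (hge.const_mul C)
  have hH0 : ∀ᵐ ξ, 0 ≤ H ξ := by
    have : ∀ᵐ ξ : En (2*m+1), ξ ≠ 0 := by
      rw [ae_iff]; simp
    filter_upwards [this] with ξ hξ
    have := hGG ξ hξ
    simp only [hHdef]; linarith
  have hHs : ∀ s : ℝ, ∫ ξ, H ξ * Real.cos (2 * Real.pi * inner ℝ w ξ * s)
      = (∫ ξ, G ξ * Real.cos (2 * Real.pi * inner ℝ w ξ * s))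
        - c * (∫ ξ, G0fun m ξ * Real.cos (2 * Real.pi * inner ℝ w ξ * s))
        + C * (D * Real.exp (-(2 * Real.pi * ‖w‖ ^ 2) * s ^ 2)) := by
    intro s
    have hb : Continuous fun ξ : En (2*m+1) => 2 * Real.pi * inner ℝ w ξ * s := by fun_prop
    have hsb : Integrable (fun ξ => G ξ * Real.cos (2 * Real.pi * inner ℝ w ξ * s)
        - c * (G0fun m ξ * Real.cos (2 * Real.pi * inner ℝ w ξ * s))) :=
      (aux_cosbd hG _ hb).sub ((aux_cosbd hG0 _ hb).const_mul c)
    rw [← hgc s, ← integral_const_mul, ← integral_const_mul,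
      ← integral_sub (aux_cosbd hG _ hb) ((aux_cosbd hG0 _ hb).const_mul c),
      ← integral_add hsb
        ((aux_cosbd hge _ hb).const_mul C)]
    congr 1; ext ξ; simp only [hHdef]; ring
  have hdec : Tendsto (fun s : ℝ => s * (C * (D * Real.exp (-(2 * Real.pi * ‖w‖ ^ 2) * s ^ 2))))
      atTop (𝓝 0) := by
    have hb : 0 < 2 * Real.pi * ‖w‖ ^ 2 := by
      have := norm_pos_iff.2 hw
      positivity
    have h1 := (rpow_mul_exp_neg_mul_sq_isLittleO_exp_neg hb 1).trans_tendsto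
      (by
        have : Tendsto (fun x : ℝ => (1/2:ℝ) * x) atTop atTop :=
          tendsto_id.const_mul_atTop (by norm_num)
        refine (Real.tendsto_exp_neg_atTop_nhds_zero.comp this).congr fun x => ?_
        simp [Function.comp])
    have h2 := h1.const_mul (C * D)
    rw [mul_zero] at h2
    refine h2.congr fun s => ?_
    rw [Real.rpow_one]; ring
  have e1 : ∀ᶠ s : ℝ in atTop, s * ∫ ξ, G ξ * Real.cos (2 * Real.pi * inner ℝ w ξ * s)
      < c * k / 4 := hl.eventually_lt_const (by nlinarith [mul_pos hc hk0])
  have e2 : ∀ᶠ s : ℝ in atTop, s * (C * (D * Real.exp (-(2 * Real.pi * ‖w‖ ^ 2) * s ^ 2)))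
      < c * k / 4 := hdec.eventually_lt_const (by nlinarith [mul_pos hc hk0])
  obtain ⟨s0, hs0⟩ := (e1.and (e2.and (eventually_ge_atTop 1))).exists_forall_of_atTop
  have h10 := (hs0 s0 le_rfl).2.2
  refine aux_log hH hH0 w (c * k / 2) s0 (by positivity) (by linarith) ?_
  intro s hs
  obtain ⟨a1, a2, a3⟩ := hs0 s hs
  have hsp : 0 < s := by linarith
  have a4 := aux_G0_cos m w s a3
  rw [← hk, div_le_iff₀ hsp] at a4
  rw [hHs s, ← neg_div, le_div_iff₀ hsp]
  have := mul_le_mul_of_nonneg_left a4 hc.le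
  nlinarith

lemma aux_Kmul {n : ℕ} {K : En n → ℝ} (hK : LocallyIntegrable K volume) {M : ℝ}
    (hM : ∀ x, 1 ≤ ‖x‖ → |K x| ≤ M) {f : En n → ℝ} (hf : Integrable f) {B : ℝ}
    (hB : ∀ x, |f x| ≤ B) :
    Integrable (fun x => K x * f x) ∧
      |∫ x, K x * f x| ≤ B * (∫ x in Metric.closedBall (0 : En n) 1, |K x|) + |M| * ∫ x, |f x| := by
  have hKi : IntegrableOn (fun x => |K x|) (Metric.closedBall (0 : En n) 1) :=
    (hK.integrableOn_isCompact (isCompact_closedBall 0 1)).abs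
  have hmeas : MeasurableSet (Metric.closedBall (0 : En n) 1) := measurableSet_closedBall
  have h1 : Integrable (fun x => B * (Metric.closedBall (0 : En n) 1).indicator (fun x => |K x|) x) :=
    ((integrable_indicator_iff hmeas).2 hKi).const_mul B
  have h2 : Integrable (fun x => |M| * |f x|) := hf.abs.const_mul |M|
  have hB0 : 0 ≤ B := (abs_nonneg _).trans (hB 0)
  have hle : ∀ x, ‖K x * f x‖ ≤
      B * (Metric.closedBall (0 : En n) 1).indicator (fun x => |K x|) x + |M| * |f x| := by
    intro x
    rw [norm_mul, Real.norm_eq_abs, Real.norm_eq_abs]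
    by_cases hx : x ∈ Metric.closedBall (0 : En n) 1
    · rw [Set.indicator_of_mem hx]
      have := mul_le_mul_of_nonneg_left (hB x) (abs_nonneg (K x))
      have h3 : 0 ≤ |M| * |f x| := by positivity
      linarith
    · rw [Set.indicator_of_notMem hx]
      simp only [Metric.mem_closedBall, dist_zero_right, not_le] at hx
      have := mul_le_mul_of_nonneg_right ((hM x hx.le).trans (le_abs_self M)) (abs_nonneg (f x))
      linarith
  have hm : AEStronglyMeasurable (fun x => K x * f x) volume :=
    hK.aestronglyMeasurable.mul hf.aestronglyMeasurable
  refine ⟨(h1.add h2).mono' hm (Filter.Eventually.of_forall hle), ?_⟩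
  have := norm_integral_le_of_norm_le (h1.add h2) (Filter.Eventually.of_forall hle)
  rw [Real.norm_eq_abs] at this
  refine this.trans (le_of_eq ?_)
  have e := integral_add h1 h2
  simp only [Pi.add_apply] at e ⊢
  rw [e, integral_const_mul, integral_const_mul, integral_indicator hmeas]

lemma aux_stdB_norm (n : ℕ) (i : Fin n) : ‖stdB n i‖ = 1 := by simp [stdB]

lemma aux_opL_le (n m : ℕ) (A : (Fin (2*m) → Fin n) → ℝ) (ψ : En n → ℝ) (x : En n) :
    |opL n m A ψ x| ≤ (∑ i, |A i|) * ‖iteratedFDeriv ℝ (2*m) ψ x‖ := by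
  unfold opL
  rw [abs_mul, abs_pow, abs_neg, abs_one, one_pow, one_mul, Finset.sum_mul]
  refine (Finset.abs_sum_le_sum_abs _ _).trans (Finset.sum_le_sum fun i _ => ?_)
  rw [abs_mul]
  refine mul_le_mul_of_nonneg_left ?_ (abs_nonneg _)
  have := (iteratedFDeriv ℝ (2*m) ψ x).le_opNorm (fun j => stdB n (i j))
  simpa [aux_stdB_norm] using this

open Filter Topology SchwartzMap in
lemma aux_ext (n m : ℕ) (A : (Fin (2*m) → Fin n) → ℝ) (K : En n → ℝ)
    (hK : LocallyIntegrable K volume) {M : ℝ}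
    (hM : ∀ x, 1 ≤ ‖x‖ → |K x| ≤ M) (hfund : IsFundamentalSolution n m A K)
    (φ : 𝓢(En n, ℝ)) : ∫ y, K y * opL n m A φ y = φ 0 := by
  let χ : ContDiffBump (0 : En n) := ⟨1, 2, one_pos, one_lt_two⟩
  have hle : ∀ k : ℕ, (k : WithTop ℕ∞) ≤ ((⊤ : ℕ∞) : WithTop ℕ∞) := fun k => by
    exact_mod_cast le_top
  have hχs : ContDiff ℝ (⊤ : ℕ∞) χ := χ.contDiff
  let χS : 𝓢(En n, ℝ) := χ.hasCompactSupport.toSchwartzMap hχs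
  have hχS : (χS : En n → ℝ) = χ := rfl
  let a : ℕ → ℝ := fun N => ((N:ℝ) + 1)⁻¹
  have ha0 : ∀ N, 0 < a N := fun N => by positivity
  have ha1 : ∀ N, a N ≤ 1 := fun N => inv_le_one_of_one_le₀ (by
    have : (0:ℝ) ≤ N := Nat.cast_nonneg N
    linarith)
  let ψ : ℕ → En n → ℝ := fun N x => χ (a N • x) * φ x
  have hsm : ∀ N, ContDiff ℝ (⊤ : ℕ∞) (fun x => χ (a N • x)) := fun N =>
    hχs.comp (contDiff_const_smul (a N))
  have hψs : ∀ N, ContDiff ℝ (⊤ : ℕ∞) (ψ N) := fun N => (hsm N).mul (φ.smooth _)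
  have hψc : ∀ N, HasCompactSupport (ψ N) := fun N =>
    (χ.hasCompactSupport.comp_smul (ha0 N).ne').mul_right
  have hψ0 : ∀ N, ψ N 0 = φ 0 := by
    intro N
    simp only [ψ, smul_zero]
    rw [χ.one_of_mem_closedBall (by simp [χ])]
    simp
  let Bi : ℕ → ℝ := fun i => SchwartzMap.seminorm ℝ 0 i χS
  have hBi : ∀ i N x, ‖iteratedFDeriv ℝ i (fun x => χ (a N • x)) x‖ ≤ Bi i := by
    intro i N x
    have h1 := iteratedFDeriv_comp_const_smul (i := i) (a N) (hχs.of_le (by exact_mod_cast le_top))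
    have h2 := congrFun h1 x
    rw [h2, norm_smul, norm_pow, Real.norm_of_nonneg (ha0 N).le]
    have h3 := SchwartzMap.norm_iteratedFDeriv_le_seminorm ℝ χS i (a N • x)
    have h4 : a N ^ i ≤ 1 := pow_le_one₀ (ha0 N).le (ha1 N)
    calc _ ≤ 1 * Bi i := by
          gcongr
          exact h3
      _ = _ := one_mul _
  let b : En n → ℝ := fun x => (∑ i, |A i|) * ∑ i ∈ Finset.range (2*m + 1),
    ((2*m).choose i : ℝ) * Bi i * ‖iteratedFDeriv ℝ (2*m - i) φ x‖
  have hBi0 : ∀ i, 0 ≤ Bi i := fun i => apply_nonneg _ _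
  have hA0 : 0 ≤ ∑ i, |A i| := Finset.sum_nonneg fun _ _ => abs_nonneg _
  have hψb : ∀ N x, |opL n m A (ψ N) x| ≤ b x := by
    intro N x
    refine (aux_opL_le n m A (ψ N) x).trans (mul_le_mul_of_nonneg_left ?_ hA0)
    refine (norm_iteratedFDeriv_mul_le (hsm N) (φ.smooth _) x (n := 2*m) (hle _)).trans ?_
    refine Finset.sum_le_sum fun i _ => ?_
    gcongr
    exact hBi i N x
  have hb0 : ∀ x, 0 ≤ b x := fun x => (abs_nonneg _).trans (hψb 0 x)
  have hbi : Integrable b := by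
    refine Integrable.const_mul (integrable_finsetSum _ fun i _ => ?_) _
    refine Integrable.const_mul ?_ _
    simpa using φ.integrable_pow_mul_iteratedFDeriv volume 0 (2*m - i)
  have hbb : ∀ x, |b x| ≤ (∑ i, |A i|) * ∑ i ∈ Finset.range (2*m + 1),
    ((2*m).choose i : ℝ) * Bi i * SchwartzMap.seminorm ℝ 0 (2*m - i) φ := by
    intro x
    rw [abs_of_nonneg (hb0 x)]
    refine mul_le_mul_of_nonneg_left (Finset.sum_le_sum fun i _ => ?_) hA0
    refine mul_le_mul_of_nonneg_left ?_ (mul_nonneg (Nat.cast_nonneg _) (hBi0 i))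
    exact SchwartzMap.norm_iteratedFDeriv_le_seminorm ℝ φ _ x
  have hdom := (aux_Kmul hK hM hbi hbb).1.norm
  have hcont : ∀ N, Continuous (opL n m A (ψ N)) := by
    intro N
    unfold opL
    refine continuous_const.mul (continuous_finsetSum _ fun i _ => continuous_const.mul ?_)
    have h1 : Continuous (iteratedFDeriv ℝ (2*m) (ψ N)) :=
      (hψs N).continuous_iteratedFDeriv (hle _)
    fun_prop
  have hlim : Tendsto (fun N => ∫ y, K y * opL n m A (ψ N) y) atTop
      (𝓝 (∫ y, K y * opL n m A φ y)) := by
    refine tendsto_integral_of_dominated_convergence (fun y => ‖K y * b y‖) ?_ hdom ?_ ?_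
    · intro N
      exact hK.aestronglyMeasurable.mul (hcont N).aestronglyMeasurable
    · intro N
      refine Eventually.of_forall fun y => ?_
      rw [norm_mul, norm_mul]
      refine mul_le_mul_of_nonneg_left ?_ (norm_nonneg _)
      rw [Real.norm_eq_abs, Real.norm_of_nonneg (hb0 y)]
      exact hψb N y
    · refine Eventually.of_forall fun y => ?_
      refine tendsto_const_nhds.congr' ?_
      obtain ⟨N0, hN0⟩ := exists_nat_gt ‖y‖
      filter_upwards [eventually_ge_atTop N0] with N hN
      have : ψ N =ᶠ[𝓝 y] φ := by
        have hop : ∀ᶠ x in 𝓝 y, ‖x‖ < N0 := 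
          (continuous_norm.tendsto y).eventually_lt_const hN0
        filter_upwards [hop] with x hx
        simp only [ψ]
        rw [χ.one_of_mem_closedBall, one_mul]
        simp only [Metric.mem_closedBall, dist_zero_right, χ]
        rw [norm_smul, Real.norm_of_nonneg (ha0 N).le]
        simp only [a]
        rw [inv_mul_le_iff₀ (by positivity)]
        have : (N0:ℝ) ≤ N := by exact_mod_cast hN
        linarith
      have h2 := (this.iteratedFDeriv ℝ (2*m)).eq_of_nhds
      unfold opL
      rw [h2]
  have hconst : (fun N => ∫ y, K y * opL n m A (ψ N) y) = fun _ => φ 0 := by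
    ext N
    rw [hfund (ψ N) (hψs N) (hψc N), hψ0 N]
  rw [hconst] at hlim
  exact tendsto_nhds_unique hlim tendsto_const_nhds |>.symm ▸ rfl

open SchwartzMap LineDeriv FourierTransform in
lemma aux_iter {n : ℕ} (k : ℕ) (v : Fin k → En n) (f : 𝓢(En n, ℂ)) :
    ∃ h : 𝓢(En n, ℂ), ∂^{v} (𝓕 f) = 𝓕 h ∧
      ∀ ξ, h ξ = (-(2 * Real.pi * Complex.I)) ^ k * (∏ j, ((inner ℝ ξ (v j) : ℝ) : ℂ)) * f ξ := by
  induction k with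
  | zero => exact ⟨f, by simp, by simp⟩
  | succ k ih =>
    obtain ⟨h, h1, h2⟩ := ih (Fin.tail v)
    refine ⟨-(2 * Real.pi * Complex.I) • smulLeftCLM ℂ (inner ℝ · (v 0)) h, ?_, ?_⟩
    · rw [iteratedLineDerivOp_succ_left, h1, SchwartzMap.lineDerivOp_fourier_eq]
    · intro ξ
      have ht : Function.HasTemperateGrowth (fun x : En n => inner ℝ x (v 0)) :=
        ((innerSL ℝ).flip (v 0)).hasTemperateGrowth
      rw [smul_apply, smulLeftCLM_apply_apply ht, h2, Fin.prod_univ_succ]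
      simp only [Fin.tail, smul_eq_mul, Complex.real_smul]
      ring

open SchwartzMap LineDeriv FourierTransform in
lemma aux_opL_fourier (n m : ℕ) (A : (Fin (2*m) → Fin n) → ℝ) (g qg : 𝓢(En n, ℂ))
    (hq : ∀ ξ, qg ξ = (symbolQ n m A ξ : ℂ) * g ξ) (x : En n) :
    opL n m A (fun x => (𝓕 g x).re) x = (2 * Real.pi) ^ (2*m) * (𝓕 qg x).re := by
  choose h h1 h2 using fun i : Fin (2*m) → Fin n => aux_iter (2*m) (fun j => stdB n (i j)) g
  have e1 : ∀ i : Fin (2*m) → Fin n, iteratedFDeriv ℝ (2*m) (fun x => (𝓕 g x).re) x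
      (fun j => stdB n (i j)) = (𝓕 (h i) x).re := by
    intro i
    rw [← h1 i, iteratedLineDerivOp_eq_iteratedFDeriv]
    have := Complex.reCLM.iteratedFDeriv_comp_left (x := x) ((𝓕 g).smooth (2*m : ℕ)).contDiffAt
      (i := 2*m) le_rfl
    have e : (fun x => (𝓕 g x).re) = Complex.reCLM ∘ ((𝓕 g : 𝓢(En n, ℂ)) : En n → ℂ) := rfl
    rw [e, this]
    rfl
  have e2 : ((-1:ℂ)^m) • ∑ i : Fin (2*m) → Fin n, (A i : ℂ) • h i = ((2 * Real.pi : ℂ) ^ (2*m)) • qg := by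
    ext ξ
    simp only [smul_apply, sum_apply, hq, symbolQ, h2, smul_eq_mul, stdB]
    push_cast
    rw [Finset.mul_sum, Finset.sum_mul, Finset.mul_sum]
    refine Finset.sum_congr rfl fun i _ => ?_
    have : (-(2 * (Real.pi:ℂ) * Complex.I)) ^ (2*m) = (2 * (Real.pi:ℂ)) ^ (2*m) * (-1)^m := by
      rw [neg_pow, mul_pow _ Complex.I, pow_mul (-1:ℂ), pow_mul Complex.I]
      simp
    rw [this]
    have h11 : ((-1:ℂ)^m) * (-1)^m = 1 := by rw [← mul_pow]; simp
    simp only [EuclideanSpace.inner_single_right]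
    simp only [one_mul, conj_trivial]
    linear_combination ((2 * (Real.pi:ℂ)) ^ (2*m) * (A i) * (∏ j, (ξ (i j) : ℂ)) * g ξ) * h11
  have e3 : ((-1:ℂ)^m) • ∑ i : Fin (2*m) → Fin n, (A i : ℂ) • 𝓕 (h i) = ((2 * Real.pi : ℂ) ^ (2*m)) • 𝓕 qg := by
    have := congrArg (fourierCLM ℂ 𝓢(En n, ℂ)) e2
    simpa using this
  have e4 := congrArg Complex.re (DFunLike.congr_fun e3 x)
  unfold opL
  simp only [e1]
  simp only [smul_apply, sum_apply, smul_eq_mul] at e4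
  have e5 : (2 * (Real.pi:ℂ)) ^ (2*m) = (((2 * Real.pi)^(2*m) : ℝ) : ℂ) := by push_cast; rfl
  have e6 : (-1:ℂ)^m = (((-1)^m : ℝ) : ℂ) := by push_cast; rfl
  rw [e5, e6, Complex.re_ofReal_mul, Complex.re_ofReal_mul, Complex.re_sum] at e4
  simp only [Complex.re_ofReal_mul] at e4
  exact e4

/-- cosine transform -/
def cosT {n : ℕ} (f : En n → ℝ) (x : En n) : ℝ :=
  ∫ ξ, f ξ * Real.cos (2 * Real.pi * inner ℝ x ξ)

open SchwartzMap FourierTransform in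
lemma aux_cosT_schwartz {n : ℕ} (f : En n → ℝ) (hs : ContDiff ℝ (⊤ : ℕ∞) f)
    (hc : HasCompactSupport f) :
    ∃ F : 𝓢(En n, ℂ), (∀ ξ, F ξ = (f ξ : ℂ)) ∧ ∀ x, (𝓕 F x).re = cosT f x := by
  have h1 : ContDiff ℝ (⊤ : ℕ∞) (fun ξ => (f ξ : ℂ)) := Complex.ofRealCLM.contDiff.comp hs
  have h2 : HasCompactSupport (fun ξ => (f ξ : ℂ)) := hc.comp_left (g := fun r : ℝ => (r:ℂ)) rfl
  refine ⟨h2.toSchwartzMap h1, fun ξ => rfl, fun x => ?_⟩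
  exact aux_fourier_re (hs.continuous.integrable_of_hasCompactSupport hc) x

lemma aux_opL_sub (n m : ℕ) (A : (Fin (2*m) → Fin n) → ℝ) (ψ : En n → ℝ) (w x : En n) :
    opL n m A (fun x => ψ (x - w)) x = opL n m A ψ (x - w) := by
  unfold opL
  rw [iteratedFDeriv_comp_sub]

lemma aux_cosT_neg {n : ℕ} (f : En n → ℝ) (x : En n) : cosT f (-x) = cosT f x := by
  unfold cosT
  simp only [inner_neg_left, mul_neg, Real.cos_neg]

lemma aux_cosT_smul {n : ℕ} (f : En n → ℝ) (x : En n) (t : ℝ) (ht : 0 < t) :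
    cosT (fun ξ => f (t • ξ)) x = (t ^ n)⁻¹ * cosT f (t⁻¹ • x) := by
  unfold cosT
  have := Measure.integral_comp_smul_of_nonneg (volume : Measure (En n))
    (fun ξ => f ξ * Real.cos (2 * Real.pi * inner ℝ (t⁻¹ • x) ξ)) t (hR := ht.le)
  simp only [finrank_euclideanSpace, Fintype.card_fin, smul_eq_mul] at this
  rw [← this]
  refine integral_congr_ae (Filter.Eventually.of_forall fun ξ => ?_)
  simp only [inner_smul_left, inner_smul_right, conj_trivial]
  rw [mul_inv_cancel_left₀ ht.ne']

open SchwartzMap FourierTransform in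
lemma aux_core (n m : ℕ) (A : (Fin (2*m) → Fin n) → ℝ) (K : En n → ℝ)
    (hK : LocallyIntegrable K volume) {M : ℝ}
    (hM : ∀ x, 1 ≤ ‖x‖ → |K x| ≤ M) (hfund : IsFundamentalSolution n m A K)
    (g u : En n → ℝ) (hg : ContDiff ℝ (⊤ : ℕ∞) g) (hgc : HasCompactSupport g)
    (hu : ContDiff ℝ (⊤ : ℕ∞) u) (huc : HasCompactSupport u)
    (hgu : ∀ ξ, u ξ = symbolQ n m A ξ * g ξ) (w : En n) :
    (2 * Real.pi) ^ (2*m) * ∫ y, K y * cosT u (y - w) = cosT g w := by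
  obtain ⟨F, hF1, hF2⟩ := aux_cosT_schwartz g hg hgc
  obtain ⟨U, hU1, hU2⟩ := aux_cosT_schwartz u hu huc
  have hop := aux_opL_fourier n m A F U (fun ξ => by rw [hF1, hU1, hgu]; push_cast; rfl)
  have he := aux_ext n m A K hK hM hfund
    ((SchwartzMap.postcompCLM Complex.reCLM (𝓕 F)).compSubConstCLM ℝ w)
  have e1 : (((SchwartzMap.postcompCLM Complex.reCLM (𝓕 F)).compSubConstCLM ℝ w : 𝓢(En n, ℝ)) :
      En n → ℝ) = fun x => (fun x => (𝓕 F x).re) (x - w) := rfl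
  rw [e1] at he
  simp only [hF2, hU2] at hop
  simp only [aux_opL_sub, hF2, zero_sub, aux_cosT_neg, hop] at he
  rw [← he, ← integral_const_mul]
  congr 1
  ext y
  ring

def auxV {n : ℕ} (K p : En n → ℝ) (w : En n) : ℝ := ∫ y, K y * p (y - w)

lemma aux_Vscale {n : ℕ} (hn : 0 < n) (K p : En n → ℝ) (hh : HomogeneousDeg n (-1) K) (w : En n) (t : ℝ)
    (ht : 0 < t) :
    ∫ y, K y * ((t ^ n)⁻¹ * p (t⁻¹ • (y - w))) = t⁻¹ * auxV K p (t⁻¹ • w) := by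
  have := Measure.integral_comp_smul_of_nonneg (volume : Measure (En n))
    (fun y => K y * p (t⁻¹ • (y - w))) t (hR := ht.le)
  simp only [finrank_euclideanSpace, Fintype.card_fin, smul_eq_mul] at this
  have e : ∫ y, K y * ((t ^ n)⁻¹ * p (t⁻¹ • (y - w))) = (t ^ n)⁻¹ * ∫ y, K y * p (t⁻¹ • (y - w)) := by
    rw [← integral_const_mul]
    congr 1
    ext y
    ring
  rw [e, ← this, auxV, ← integral_const_mul]
  have : Nonempty (Fin n) := ⟨⟨0, hn⟩⟩
  refine integral_congr_ae ?_
  filter_upwards [compl_mem_ae_iff.2 (measure_singleton (0 : En n))] with y hy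
  have hy' : y ≠ 0 := hy
  rw [hh t ht.ne' y hy', abs_of_pos ht, Real.rpow_neg_one, smul_sub, smul_smul,
    inv_mul_cancel₀ ht.ne', one_smul, mul_assoc]

lemma aux_Q_smooth (n m : ℕ) (A : (Fin (2*m) → Fin n) → ℝ) :
    ContDiff ℝ (⊤ : ℕ∞) (symbolQ n m A) := by
  unfold symbolQ
  refine ContDiff.sum fun i _ => contDiff_const.mul (contDiff_prod fun j _ => ?_)
  exact (EuclideanSpace.proj (i j) : En n →L[ℝ] ℝ).contDiff

lemma aux_Q_le (n m : ℕ) (A : (Fin (2*m) → Fin n) → ℝ) (ξ : En n) :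
    symbolQ n m A ξ ≤ (∑ i, |A i|) * ‖ξ‖ ^ (2*m) := by
  unfold symbolQ
  rw [Finset.sum_mul]
  refine Finset.sum_le_sum fun i _ => (le_abs_self _).trans ?_
  rw [abs_mul]
  refine mul_le_mul_of_nonneg_left ?_ (abs_nonneg _)
  rw [Finset.abs_prod]
  refine (Finset.prod_le_prod (fun _ _ => abs_nonneg _) (g := fun _ => ‖ξ‖) fun j _ => ?_).trans ?_
  · exact PiLp.norm_apply_le ξ (i j)
  · simp

def auxχ (n : ℕ) : ContDiffBump (0 : En n) := ⟨1, 2, one_pos, one_lt_two⟩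

lemma auxχ_one {n : ℕ} {ξ : En n} (h : ‖ξ‖ ≤ 1) : auxχ n ξ = 1 :=
  (auxχ n).one_of_mem_closedBall (by simpa [auxχ] using h)

lemma auxχ_zero {n : ℕ} {ξ : En n} (h : 2 ≤ ‖ξ‖) : auxχ n ξ = 0 :=
  (auxχ n).zero_of_le_dist (by simpa [auxχ] using h)

lemma auxχ_smooth (n : ℕ) : ContDiff ℝ (⊤ : ℕ∞) (auxχ n) := (auxχ n).contDiff

lemma aux_p_int (n : ℕ) : ∃ p : SchwartzMap (En n) ℝ, (∀ x, p x = cosT (auxχ n) x) ∧ ∫ x, p x = 1 := by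
  obtain ⟨F, hF1, hF2⟩ := aux_cosT_schwartz (auxχ n) (auxχ_smooth n) (auxχ n).hasCompactSupport
  refine ⟨SchwartzMap.postcompCLM Complex.reCLM (FourierTransform.fourier F), fun x => hF2 x, ?_⟩
  have h1 : FourierTransformInv.fourierInv (FourierTransform.fourier F) = F := by simp
  have h2 := DFunLike.congr_fun h1 0
  rw [SchwartzMap.fourierInv_coe, Real.fourierInv_eq, hF1, auxχ_one (by simp)] at h2
  simp only [inner_zero_right, AddChar.map_zero_eq_one, one_smul] at h2
  have h3 := (Complex.reCLM.integral_comp_comm (FourierTransform.fourier F).integrable (μ := volume))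
  rw [h2] at h3
  exact h3.trans (by simp)

lemma aux_gt (m : ℕ) (hm : 1 ≤ m)
    (A : (Fin (2*m) → Fin (2*m+1)) → ℝ) (lam : ℝ) (hlam : 0 < lam)
    (hell : ∀ ξ : En (2*m+1), lam * ‖ξ‖^(2*m) ≤ symbolQ (2*m+1) m A ξ)
    (K : En (2*m+1) → ℝ)
    (hK : LocallyIntegrable K volume) {M : ℝ}
    (hM : ∀ x, 1 ≤ ‖x‖ → |K x| ≤ M)
    (hh : HomogeneousDeg (2*m+1) (-1 : ℝ) K)
    (hfund : IsFundamentalSolution (2*m+1) m A K) (t : ℝ) (ht : 1 ≤ t) (w : En (2*m+1)) :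
    (2 * Real.pi) ^ (2*m) * (auxV K (cosT (auxχ _)) w - t⁻¹ * auxV K (cosT (auxχ _)) (t⁻¹ • w)) =
      cosT (fun ξ => (auxχ _ ξ - auxχ _ (t • ξ)) / symbolQ (2*m+1) m A ξ) w := by
  have ht0 : 0 < t := by linarith
  set u : En (2*m+1) → ℝ := fun ξ => auxχ _ ξ - auxχ _ (t • ξ) with hu
  set g : En (2*m+1) → ℝ := fun ξ => u ξ / symbolQ (2*m+1) m A ξ with hg
  have hχt : ContDiff ℝ (⊤ : ℕ∞) (fun ξ => auxχ (2*m+1) (t • ξ)) :=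
    (auxχ_smooth _).comp (contDiff_const_smul t)
  have hχtc : HasCompactSupport (fun ξ => auxχ (2*m+1) (t • ξ)) :=
    (auxχ _).hasCompactSupport.comp_smul ht0.ne'
  have hus : ContDiff ℝ (⊤ : ℕ∞) u := (auxχ_smooth _).sub hχt
  have huc : HasCompactSupport u := (auxχ _).hasCompactSupport.sub hχtc
  have hQpos : ∀ ξ : En (2*m+1), ξ ≠ 0 → 0 < symbolQ (2*m+1) m A ξ := fun ξ hξ =>
    lt_of_lt_of_le (by have := norm_pos_iff.2 hξ; positivity) (hell ξ)
  have hu0 : ∀ ξ : En (2*m+1), ‖ξ‖ < t⁻¹ → u ξ = 0 := by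
    intro ξ hξ
    have h1 : ‖t • ξ‖ ≤ 1 := by
      rw [norm_smul, Real.norm_of_nonneg ht0.le]
      have := mul_le_mul_of_nonneg_left hξ.le ht0.le
      rwa [mul_inv_cancel₀ ht0.ne'] at this
    have h2 : ‖ξ‖ ≤ 1 := hξ.le.trans (inv_le_one_of_one_le₀ ht)
    simp only [hu, auxχ_one h1, auxχ_one h2, sub_self]
  have hgs : ContDiff ℝ (⊤ : ℕ∞) g := by
    rw [contDiff_iff_contDiffAt]
    intro ξ
    by_cases hξ : ξ = 0
    · have : g =ᶠ[nhds ξ] fun _ => 0 := by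
        have hop : ∀ᶠ x in nhds ξ, ‖x‖ < t⁻¹ :=
          (continuous_norm.tendsto ξ).eventually_lt_const (by rw [hξ, norm_zero]; positivity)
        filter_upwards [hop] with x hx
        simp only [hg, hu0 x hx, zero_div]
      exact contDiffAt_const.congr_of_eventuallyEq this
    · exact hus.contDiffAt.div (aux_Q_smooth _ _ _).contDiffAt (hQpos ξ hξ).ne'
  have hgc : HasCompactSupport g := by
    simp only [hg, div_eq_mul_inv]
    exact huc.mul_right
  have hgu : ∀ ξ, u ξ = symbolQ (2*m+1) m A ξ * g ξ := by
    intro ξ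
    by_cases hξ : ξ = 0
    · have : u ξ = 0 := hu0 ξ (by rw [hξ, norm_zero]; positivity)
      simp only [hg, this, zero_div, mul_zero]
    · simp only [hg]
      field_simp [(hQpos ξ hξ).ne']
  rw [← aux_core _ m A K hK hM hfund g u hgs hgc hus huc hgu w]
  congr 1
  obtain ⟨p, hp, -⟩ := aux_p_int (2*m+1)
  have hi1 : Integrable (auxχ (2*m+1)) :=
    (auxχ_smooth _).continuous.integrable_of_hasCompactSupport (auxχ _).hasCompactSupport
  have hi2 : Integrable (fun ξ => auxχ (2*m+1) (t • ξ)) :=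
    hχt.continuous.integrable_of_hasCompactSupport hχtc
  have hcu : ∀ x, cosT u x = p x - (t ^ (2*m+1))⁻¹ * p (t⁻¹ • x) := by
    intro x
    rw [hp, hp, ← aux_cosT_smul _ _ _ ht0]
    unfold cosT
    rw [← integral_sub (aux_cosbd hi1 _ (by fun_prop)) (aux_cosbd hi2 _ (by fun_prop))]
    simp only [hu, sub_mul]
  have hpe : cosT (auxχ (2*m+1)) = p := by ext x; rw [hp]
  rw [hpe, ← aux_Vscale (by omega) K p hh w t ht0]
  have hB : ∀ x, |p x| ≤ SchwartzMap.seminorm ℝ 0 0 p := fun x => by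
    simpa using SchwartzMap.norm_le_seminorm ℝ p x
  have k1 : Integrable (fun y => K y * p (y - w)) :=
    (aux_Kmul hK hM (p.integrable.comp_sub_right w) (fun x => hB _)).1
  have k2 : Integrable (fun y => K y * ((t ^ (2*m+1))⁻¹ * p (t⁻¹ • (y - w)))) := by
    have h0 : Integrable (fun x => p (t⁻¹ • x)) := p.integrable.comp_smul (inv_ne_zero ht0.ne')
    refine (aux_Kmul hK hM ((h0.comp_sub_right w).const_mul _)
      (B := (t ^ (2*m+1))⁻¹ * SchwartzMap.seminorm ℝ 0 0 p) (fun x => ?_)).1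
    rw [abs_mul, abs_of_pos (by positivity)]
    exact mul_le_mul_of_nonneg_left (hB _) (by positivity)
  rw [auxV, ← integral_sub k1 k2]
  congr 1
  ext y
  rw [hcu]
  ring

lemma aux_H_int (m : ℕ) : IntegrableOn (fun ξ : En (2*m+1) => (‖ξ‖ ^ (2*m))⁻¹)
    (Metric.ball 0 2) := by
  rw [integrableOn_fun_norm_addHaar (volume : Measure (En (2*m+1))) (f := fun y : ℝ => (y ^ (2*m))⁻¹)]
  have h : IntegrableOn (fun _ : ℝ => (1:ℝ)) (Set.Ioo 0 2) := by
    simp [integrableOn_const_iff]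
  refine h.congr_fun (fun y hy => ?_) measurableSet_Ioo
  have : y ^ (2*m) ≠ 0 := pow_ne_zero _ hy.1.ne'
  simp [this]

lemma aux_divQ (m : ℕ) (hm : 1 ≤ m)
    (A : (Fin (2*m) → Fin (2*m+1)) → ℝ) (lam : ℝ) (hlam : 0 < lam)
    (hell : ∀ ξ : En (2*m+1), lam * ‖ξ‖^(2*m) ≤ symbolQ (2*m+1) m A ξ)
    (v : ℝ) (hv : |v| ≤ 1) (ξ : En (2*m+1)) (hv2 : 2 ≤ ‖ξ‖ → v = 0) :
    ‖v / symbolQ (2*m+1) m A ξ‖ ≤ (Metric.ball (0 : En (2*m+1)) 2).indicator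
      (fun ξ => lam⁻¹ * (‖ξ‖ ^ (2*m))⁻¹) ξ := by
  by_cases h2 : 2 ≤ ‖ξ‖
  · rw [hv2 h2]
    simp only [zero_div, norm_zero]
    exact Set.indicator_nonneg (fun x _ => by positivity) ξ
  · rw [Set.indicator_of_mem (by simpa using h2)]
    by_cases h0 : ξ = 0
    · have hQ : symbolQ (2*m+1) m A ξ = 0 := by
        have h1 := hell ξ
        have h2 := aux_Q_le _ m A ξ
        have h3 : 2 * m ≠ 0 := by omega
        rw [h0, norm_zero, zero_pow h3, mul_zero] at h1 h2
        rw [h0]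
        exact le_antisymm h2 h1
      rw [hQ, div_zero, norm_zero]
      positivity
    · have hp := norm_pos_iff.2 h0
      have h3 : 0 < lam * ‖ξ‖ ^ (2*m) := by positivity
      rw [norm_div, Real.norm_eq_abs, Real.norm_of_nonneg (h3.le.trans (hell ξ)), ← mul_inv]
      rw [← one_div]
      exact div_le_div₀ zero_le_one hv h3 (hell ξ)

lemma aux_G_meas (m : ℕ) (A : (Fin (2*m) → Fin (2*m+1)) → ℝ) (f : En (2*m+1) → ℝ) (hf : Continuous f) :
    AEStronglyMeasurable (fun ξ => f ξ / symbolQ (2*m+1) m A ξ) volume :=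
  (hf.measurable.div (aux_Q_smooth _ m A).continuous.measurable).aestronglyMeasurable

open Filter Topology in
lemma aux_lim (m : ℕ) (hm : 1 ≤ m)
    (A : (Fin (2*m) → Fin (2*m+1)) → ℝ) (lam : ℝ) (hlam : 0 < lam)
    (hell : ∀ ξ : En (2*m+1), lam * ‖ξ‖^(2*m) ≤ symbolQ (2*m+1) m A ξ)
    (K : En (2*m+1) → ℝ)
    (hK : LocallyIntegrable K volume) {M : ℝ}
    (hM : ∀ x, 1 ≤ ‖x‖ → |K x| ≤ M)
    (hh : HomogeneousDeg (2*m+1) (-1 : ℝ) K)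
    (hfund : IsFundamentalSolution (2*m+1) m A K) :
    Integrable (fun ξ => auxχ _ ξ / symbolQ (2*m+1) m A ξ) ∧ ∀ w : En (2*m+1),
    (2 * Real.pi) ^ (2*m) * auxV K (cosT (auxχ _)) w =
      cosT (fun ξ => auxχ _ ξ / symbolQ (2*m+1) m A ξ) w := by
  have hHi : Integrable ((Metric.ball (0 : En (2*m+1)) 2).indicator
      (fun ξ => lam⁻¹ * (‖ξ‖ ^ (2*m))⁻¹)) :=
    (integrable_indicator_iff measurableSet_ball).2 ((aux_H_int m).const_mul lam⁻¹)
  have hχc : Continuous (auxχ (2*m+1)) := (auxχ_smooth _).continuous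
  refine ⟨hHi.mono' (aux_G_meas m A _ hχc) (Eventually.of_forall fun ξ => ?_), fun w => ?_⟩
  · refine aux_divQ m hm A lam hlam hell _ ?_ ξ (fun h => auxχ_zero h)
    rw [abs_of_nonneg (auxχ _).nonneg]
    exact (auxχ _).le_one
  obtain ⟨p, hp, -⟩ := aux_p_int (2*m+1)
  have hpe : cosT (auxχ (2*m+1)) = p := by ext x; rw [hp]
  have hB : ∀ x, |p x| ≤ SchwartzMap.seminorm ℝ 0 0 p := fun x => by
    simpa using SchwartzMap.norm_le_seminorm ℝ p x
  obtain ⟨Bd, hBd⟩ : ∃ Bd, ∀ w, |auxV K p w| ≤ Bd := by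
    refine ⟨SchwartzMap.seminorm ℝ 0 0 p * (∫ x in Metric.closedBall (0 : En (2*m+1)) 1, |K x|)
      + |M| * ∫ x, |p x|, fun w => (aux_Kmul hK hM (p.integrable.comp_sub_right w)
      (fun x => hB _)).2.trans (le_of_eq ?_)⟩
    rw [integral_sub_right_eq_self (fun x => |p x|) w]
  have L1 : Tendsto (fun t : ℝ => (2 * Real.pi) ^ (2*m) * (auxV K (cosT (auxχ _)) w
      - t⁻¹ * auxV K (cosT (auxχ _)) (t⁻¹ • w))) atTop
      (𝓝 ((2 * Real.pi) ^ (2*m) * (auxV K (cosT (auxχ _)) w - 0))) := by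
    refine Tendsto.const_mul _ (Tendsto.const_sub _ ?_)
    have h0 : Tendsto (fun t : ℝ => t⁻¹ * Bd) atTop (𝓝 0) := by
      simpa using (tendsto_inv_atTop_zero (𝕜 := ℝ)).mul_const Bd
    refine squeeze_zero_norm' ?_ h0
    filter_upwards [eventually_gt_atTop 0] with t ht
    rw [norm_mul, Real.norm_of_nonneg (inv_pos.2 ht).le, hpe]
    exact mul_le_mul_of_nonneg_left (hBd _) (inv_pos.2 ht).le
  have L2 : Tendsto (fun t : ℝ => cosT (fun ξ => (auxχ _ ξ - auxχ _ (t • ξ)) / symbolQ (2*m+1) m A ξ) w)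
      atTop (𝓝 (cosT (fun ξ => auxχ _ ξ / symbolQ (2*m+1) m A ξ) w)) := by
    unfold cosT
    refine tendsto_integral_filter_of_dominated_convergence _ ?_ ?_ hHi ?_
    · refine Eventually.of_forall fun t => ?_
      exact (aux_G_meas m A (fun ξ => auxχ _ ξ - auxχ _ (t • ξ))
        (hχc.sub (hχc.comp (continuous_const_smul t)))).mul
        (Continuous.aestronglyMeasurable (by fun_prop))
    · filter_upwards [eventually_ge_atTop 1] with t ht
      refine Eventually.of_forall fun ξ => ?_
      rw [norm_mul]
      refine (mul_le_of_le_one_right (norm_nonneg _) (Real.abs_cos_le_one _)).trans ?_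
      refine aux_divQ m hm A lam hlam hell _ ?_ ξ (fun h => ?_)
      · have h1 := (auxχ (2*m+1)).nonneg (x := ξ)
        have h2 := (auxχ (2*m+1)).le_one (x := ξ)
        have h3 := (auxχ (2*m+1)).nonneg (x := t • ξ)
        have h4 := (auxχ (2*m+1)).le_one (x := t • ξ)
        rw [abs_le]
        constructor <;> linarith
      · rw [auxχ_zero h, auxχ_zero, sub_zero]
        rw [norm_smul, Real.norm_of_nonneg (by linarith)]
        nlinarith
    · have hne : ∀ᵐ ξ : En (2*m+1), ξ ≠ 0 := compl_mem_ae_iff.2 (measure_singleton _)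
      filter_upwards [hne] with ξ hξ
      refine tendsto_const_nhds.congr' ?_
      have hp := norm_pos_iff.2 hξ
      filter_upwards [eventually_ge_atTop (2 / ‖ξ‖), eventually_gt_atTop 0] with t ht ht0
      rw [auxχ_zero (ξ := t • ξ), sub_zero]
      rw [norm_smul, Real.norm_of_nonneg ht0.le]
      rwa [div_le_iff₀ hp] at ht
  have L3 := L2.congr' (f₂ := fun t : ℝ => (2 * Real.pi) ^ (2*m) * (auxV K (cosT (auxχ _)) w
      - t⁻¹ * auxV K (cosT (auxχ _)) (t⁻¹ • w))) (by
    filter_upwards [eventually_ge_atTop 1] with t ht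
    rw [aux_gt m hm A lam hlam hell K hK hM hh hfund t ht w])
  have := tendsto_nhds_unique L1 L3
  rwa [sub_zero] at this

lemma aux_Kbd {n : ℕ} (K : En n → ℝ) (hc : ContinuousOn K {(0 : En n)}ᶜ)
    (hh : HomogeneousDeg n (-1 : ℝ) K) : ∃ C, 0 ≤ C ∧ ∀ x, x ≠ 0 → |K x| ≤ C * ‖x‖⁻¹ := by
  have hcs : ContinuousOn K (Metric.sphere (0 : En n) 1) := hc.mono fun x hx => by
    simp only [mem_sphere_zero_iff_norm] at hx
    intro h
    rw [Set.mem_singleton_iff] at h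
    simp [h] at hx
  obtain ⟨C, hC⟩ := (isCompact_sphere (0 : En n) 1).exists_bound_of_continuousOn hcs
  refine ⟨|C|, abs_nonneg _, fun x hx => ?_⟩
  have hp := norm_pos_iff.2 hx
  have h1 := hh ‖x‖ hp.ne' (‖x‖⁻¹ • x) (smul_ne_zero (inv_ne_zero hp.ne') hx)
  rw [smul_smul, mul_inv_cancel₀ hp.ne', one_smul, abs_of_pos hp, Real.rpow_neg_one] at h1
  rw [h1, abs_mul, abs_of_pos (inv_pos.2 hp), mul_comm]
  refine mul_le_mul_of_nonneg_right ((hC _ ?_).trans (le_abs_self C)) (inv_pos.2 hp).le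
  rw [mem_sphere_zero_iff_norm, norm_smul, norm_inv, norm_norm, inv_mul_cancel₀ hp.ne']

open Filter Topology in
lemma aux_Klim {n : ℕ} (hn : 0 < n) (K : En n → ℝ) (hK : LocallyIntegrable K volume)
    (hc : ContinuousOn K {(0 : En n)}ᶜ)
    (hh : HomogeneousDeg n (-1 : ℝ) K) (p : SchwartzMap (En n) ℝ) (hp1 : ∫ x, p x = 1)
    (w : En n) (hw : w ≠ 0) :
    Tendsto (fun s : ℝ => s * auxV K p (s • w)) atTop (𝓝 (K w)) := by
  obtain ⟨C, hC0, hC⟩ := aux_Kbd K hc hh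
  have hwp := norm_pos_iff.2 hw
  set r := ‖w‖ / 2 with hr
  have hr0 : 0 < r := by positivity
  set U := Metric.ball (0 : En n) r with hU
  have hUm : MeasurableSet U := measurableSet_ball
  set K1 : En n → ℝ := U.indicator K with hK1
  set K2 : En n → ℝ := Uᶜ.indicator K with hK2
  have hKm : Measurable K := measurable_of_continuousOn_compl_singleton 0 hc
  have hK2m : Measurable K2 := hKm.indicator hUm.compl
  have hK12 : ∀ y, K y = K1 y + K2 y := fun y => by
    rw [hK1, hK2, Set.indicator_self_add_compl_apply]
  have hK2b : ∀ y, |K2 y| ≤ C * r⁻¹ := by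
    intro y
    by_cases hy : y ∈ U
    · have : K2 y = 0 := Set.indicator_of_notMem (by simpa using hy) _
      rw [this, abs_zero]
      positivity
    · have : K2 y = K y := Set.indicator_of_mem (by simpa using hy) _
      rw [this]
      have hy' : r ≤ ‖y‖ := by simpa [hU] using hy
      refine (hC y (norm_pos_iff.1 (hr0.trans_le hy'))).trans ?_
      gcongr
  have hK1i : Integrable K1 := (integrable_indicator_iff hUm).2
    ((hK.integrableOn_isCompact (isCompact_closedBall 0 r)).mono_set Metric.ball_subset_closedBall)
  have hB : ∀ x, |p x| ≤ SchwartzMap.seminorm ℝ 0 0 p := fun x => by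
    simpa using SchwartzMap.norm_le_seminorm ℝ p x
  set D := SchwartzMap.seminorm ℝ (n+1) 0 p with hD
  have hD0 : 0 ≤ D := apply_nonneg _ _
  have hdec : ∀ x, ‖x‖ ^ (n+1) * |p x| ≤ D := fun x => by
    simpa using SchwartzMap.norm_pow_mul_le_seminorm ℝ p (n+1) x
  have hps : ∀ s : ℝ, 0 < s → Integrable (fun y => s ^ n * p (s • (y - w))) := fun s hs =>
    (((p.integrable (μ := volume)).comp_smul hs.ne').comp_sub_right w).const_mul _
  have hpsb : ∀ s : ℝ, 0 < s → ∀ y, ‖s ^ n * p (s • (y - w))‖ ≤ s ^ n * SchwartzMap.seminorm ℝ 0 0 p :=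
    fun s hs y => by
      rw [norm_mul, Real.norm_of_nonneg (by positivity)]
      exact mul_le_mul_of_nonneg_left (hB _) (by positivity)
  have i1 : ∀ s : ℝ, 0 < s → Integrable (fun y => K1 y * (s ^ n * p (s • (y - w)))) := fun s hs =>
    hK1i.mul_bdd (hps s hs).aestronglyMeasurable (Eventually.of_forall (hpsb s hs))
  have i2 : ∀ s : ℝ, 0 < s → Integrable (fun y => K2 y * (s ^ n * p (s • (y - w)))) := fun s hs =>
    (hps s hs).bdd_mul hK2m.aestronglyMeasurable (Eventually.of_forall hK2b)
  have T1 : Tendsto (fun s : ℝ => ∫ y, K1 y * (s ^ n * p (s • (y - w)))) atTop (𝓝 0) := by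
    have h0 : Tendsto (fun s : ℝ => s⁻¹ * (D * (r ^ (n+1))⁻¹ * ∫ y, ‖K1 y‖)) atTop (𝓝 0) := by
      simpa using (tendsto_inv_atTop_zero (𝕜 := ℝ)).mul_const (D * (r ^ (n+1))⁻¹ * ∫ y, ‖K1 y‖)
    refine squeeze_zero_norm' ?_ h0
    filter_upwards [eventually_gt_atTop 0] with s hs
    rw [← mul_assoc, ← integral_const_mul]
    refine norm_integral_le_of_norm_le (hK1i.norm.const_mul _) (Eventually.of_forall fun y => ?_)
    rw [norm_mul, mul_comm]
    by_cases hy : y ∈ U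
    · refine mul_le_mul_of_nonneg_right ?_ (norm_nonneg _)
      have hyr : ‖y‖ < r := by simpa [hU] using hy
      have hyw : r ≤ ‖y - w‖ := by
        have := norm_sub_norm_le w y
        rw [norm_sub_rev] at this
        have : ‖w‖ = 2 * r := by rw [hr]; ring
        linarith
      have h1 := hdec (s • (y - w))
      have h2 : (s * r) ^ (n+1) ≤ ‖s • (y - w)‖ ^ (n+1) := by
        rw [norm_smul, Real.norm_of_nonneg hs.le]
        gcongr
      have h3 : (s * r) ^ (n+1) * |p (s • (y - w))| ≤ D :=
        (mul_le_mul_of_nonneg_right h2 (abs_nonneg _)).trans h1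
      rw [norm_mul, Real.norm_of_nonneg (by positivity), Real.norm_eq_abs]
      have h4 : s ^ n * |p (s • (y - w))| = s⁻¹ * (r ^ (n+1))⁻¹ * ((s * r) ^ (n+1) * |p (s • (y - w))|) := by
        rw [mul_pow]
        field_simp
        ring
      rw [h4]
      calc _ ≤ s⁻¹ * (r ^ (n+1))⁻¹ * D := by gcongr
        _ = _ := by ring
    · have : K1 y = 0 := Set.indicator_of_notMem hy _
      rw [this]
      simp
  have T2 : Tendsto (fun s : ℝ => ∫ y, K2 y * (s ^ n * p (s • (y - w)))) atTop (𝓝 (K w)) := by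
    have e : ∀ s : ℝ, 0 < s → ∫ x, K2 (w + s⁻¹ • x) * p x = ∫ y, K2 y * (s ^ n * p (s • (y - w))) := by
      intro s hs
      have h1 := Measure.integral_comp_smul_of_nonneg (volume : Measure (En n))
        (fun x => K2 (w + s⁻¹ • x) * p x) s (hR := hs.le)
      simp only [finrank_euclideanSpace, Fintype.card_fin, smul_eq_mul, smul_smul,
        inv_mul_cancel₀ hs.ne', one_smul] at h1
      have h2 := integral_sub_right_eq_self (μ := (volume : Measure (En n)))
        (fun x => K2 (w + x) * p (s • x)) w
      simp only [add_sub_cancel] at h2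
      have h3 : ∫ y, K2 y * (s ^ n * p (s • (y - w))) = s ^ n * ∫ y, K2 y * p (s • (y - w)) := by
        rw [← integral_const_mul]
        congr 1
        ext y
        ring
      rw [h3, h2, h1, ← mul_assoc, mul_inv_cancel₀ (by positivity), one_mul]
    have hlim : Tendsto (fun s : ℝ => ∫ x, K2 (w + s⁻¹ • x) * p x) atTop (𝓝 (∫ x, K w * p x)) := by
      refine tendsto_integral_filter_of_dominated_convergence (fun x => C * r⁻¹ * |p x|) ?_ ?_ ?_ ?_
      · refine Eventually.of_forall fun s => ?_
        have : Measurable (fun x : En n => K2 (w + s⁻¹ • x)) := hK2m.comp (by fun_prop)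
        exact this.aestronglyMeasurable.mul p.continuous.aestronglyMeasurable
      · refine Eventually.of_forall fun s => Eventually.of_forall fun x => ?_
        rw [norm_mul]
        exact mul_le_mul_of_nonneg_right (hK2b _) (abs_nonneg _)
      · exact p.integrable.abs.const_mul _
      · refine Eventually.of_forall fun x => ?_
        refine Tendsto.mul_const _ ?_
        have t1 : Tendsto (fun s : ℝ => w + s⁻¹ • x) atTop (𝓝 w) := by
          have := ((tendsto_inv_atTop_zero (𝕜 := ℝ)).smul_const x).const_add w
          simpa using this
        have t2 : Tendsto K (𝓝 w) (𝓝 (K w)) :=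
          hc.continuousAt (isOpen_compl_singleton.mem_nhds hw)
        have t3 : Tendsto K2 (𝓝 w) (𝓝 (K w)) := by
          refine t2.congr' ?_
          have hop : ∀ᶠ y in 𝓝 w, r < ‖y‖ :=
            (continuous_norm.tendsto w).eventually_const_lt (by rw [hr]; linarith)
          filter_upwards [hop] with y hy
          exact (Set.indicator_of_mem (by simpa [hU] using hy.le) _).symm
        exact t3.comp t1
    rw [integral_const_mul, hp1, mul_one] at hlim
    refine hlim.congr' ?_
    filter_upwards [eventually_gt_atTop 0] with s hs using e s hs
  have T := T1.add T2
  rw [zero_add] at T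
  refine T.congr' ?_
  filter_upwards [eventually_gt_atTop 0] with s hs
  have h := aux_Vscale hn K p hh w s⁻¹ (inv_pos.2 hs)
  simp only [inv_inv, inv_pow] at h
  rw [← h, ← integral_add (i1 s hs) (i2 s hs)]
  congr 1
  ext y
  rw [hK12 y]
  ring

/-- In dimension n = 2m+1 the (−1)-homogeneous fundamental solution
is everywhere positive. -/
theorem stmt5 (m : ℕ) (hm : 1 ≤ m)
    (A : (Fin (2*m) → Fin (2*m+1)) → ℝ) (lam : ℝ) (hlam : 0 < lam)
    (hell : ∀ ξ : En (2*m+1), lam * ‖ξ‖^(2*m) ≤ symbolQ (2*m+1) m A ξ)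
    (K : En (2*m+1) → ℝ)
    (hKloc : LocallyIntegrable K volume)
    (hKcont : ContinuousOn K {(0 : En (2*m+1))}ᶜ)
    (hKhom : HomogeneousDeg (2*m+1) (-1 : ℝ) K)
    (hKfund : IsFundamentalSolution (2*m+1) m A K) :
    ∀ y : En (2*m+1), y ≠ 0 → 0 < K y := by
  intro w hw
  obtain ⟨CK, hCK0, hCK⟩ := aux_Kbd K hKcont hKhom
  have hM : ∀ x : En (2*m+1), 1 ≤ ‖x‖ → |K x| ≤ CK := by
    intro x hx
    refine (hCK x (norm_pos_iff.1 (by linarith))).trans ?_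
    exact mul_le_of_le_one_right hCK0 (inv_le_one_of_one_le₀ hx)
  obtain ⟨hGi, hV⟩ := aux_lim m hm A lam hlam hell K hKloc hM hKhom hKfund
  obtain ⟨p, hp, hp1⟩ := aux_p_int (2*m+1)
  have hpe : cosT (auxχ (2*m+1)) = p := by ext x; rw [hp]
  have hlim := (aux_Klim (by omega) K hKloc hKcont hKhom p hp1 w hw).const_mul
    ((2 * Real.pi) ^ (2*m))
  obtain ⟨C0, hC0, hG0⟩ := aux_G0_le m hm
  have hS0 : 0 ≤ ∑ i, |A i| := Finset.sum_nonneg fun _ _ => abs_nonneg _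
  set Λ := (∑ i, |A i|) + 1 with hΛ
  have hΛ0 : 0 < Λ := by linarith
  have key := aux_pos m _ hGi (C0 * Λ)⁻¹ Λ⁻¹ (by positivity) ?_ w hw
    ((2 * Real.pi) ^ (2*m) * K w) ?_
  · exact pos_of_mul_pos_right key (by positivity) 
  · intro ξ hξ
    have hξp := norm_pos_iff.2 hξ
    have hQpos : 0 < symbolQ (2*m+1) m A ξ := lt_of_lt_of_le (by positivity) (hell ξ)
    have h1 : (C0 * Λ)⁻¹ * G0fun m ξ ≤
        Λ⁻¹ * (‖ξ‖ ^ (2*m))⁻¹ * Real.exp (-(Real.pi / 2) * ‖ξ‖ ^ 2) := by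
      have := mul_le_mul_of_nonneg_left (hG0 ξ hξ) (show 0 ≤ (C0 * Λ)⁻¹ by positivity)
      refine this.trans (le_of_eq ?_)
      field_simp
    have hee : Real.exp (-(Real.pi * (1/2)) * ‖ξ‖ ^ 2) = Real.exp (-(Real.pi / 2) * ‖ξ‖ ^ 2) := by
      congr 1
      ring
    rw [hee]
    set e := Real.exp (-(Real.pi / 2) * ‖ξ‖ ^ 2) with he
    have he0 : 0 < e := Real.exp_pos _
    have he1 : e ≤ 1 := Real.exp_le_one_iff.2 (by
      have := Real.pi_pos
      have : 0 ≤ Real.pi / 2 * ‖ξ‖ ^ 2 := by positivity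
      linarith)
    have hpw : 0 < ‖ξ‖ ^ (2*m) := by positivity
    by_cases h2 : ‖ξ‖ ≤ 1
    · rw [auxχ_one h2]
      have h3 : Λ⁻¹ * (‖ξ‖ ^ (2*m))⁻¹ ≤ 1 / symbolQ (2*m+1) m A ξ := by
        rw [← mul_inv, ← one_div]
        refine one_div_le_one_div_of_le hQpos ((aux_Q_le _ m A ξ).trans ?_)
        refine mul_le_mul_of_nonneg_right ?_ hpw.le
        linarith
      have h4 : Λ⁻¹ * (‖ξ‖ ^ (2*m))⁻¹ * e ≤ Λ⁻¹ * (‖ξ‖ ^ (2*m))⁻¹ :=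
        mul_le_of_le_one_right (by positivity) he1
      have h5 : 0 < Λ⁻¹ * e := by positivity
      linarith
    · push Not at h2
      have h3 : 0 ≤ auxχ (2*m+1) ξ / symbolQ (2*m+1) m A ξ :=
        div_nonneg (auxχ _).nonneg hQpos.le
      have h4 : Λ⁻¹ * (‖ξ‖ ^ (2*m))⁻¹ * e ≤ Λ⁻¹ * e := by
        refine mul_le_mul_of_nonneg_right ?_ he0.le
        refine mul_le_of_le_one_right (by positivity) (inv_le_one_of_one_le₀ (one_le_pow₀ h2.le))
      linarith
  · refine hlim.congr fun s => ?_
    have h1 := hV (s • w)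
    rw [hpe] at h1
    rw [mul_left_comm, h1, cosT]
    congr 2
    ext ξ
    rw [inner_smul_left, conj_trivial]
    congr 2
    ring
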